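/- Let (Ω, Σ, μ) be a σ-finite measure space and let T : L¹(μ) → L¹(μ) be a positive linear contraction. Then exactly one of the following alternatives holds: either ‖T^{n+1} − T^n‖ = 2 for every n ∈ ℕ, or lim_{n→∞} ‖T^{n+1} − T^n‖ = 0. -/

import Mathlib

open MeasureTheory Filter

section BinomialAverages

/-- The binomial expansion of `n (1 - X) (1 + X) ^ (n - 1)`, with `n = j + 1`. -/
theorem Polynomial.one_sub_X_mul_one_add_X_pow (j : ℕ) :
    ((j + 1 : ℝ) • ((1 - X) * (1 + X) ^ j) : Polynomial ℝ) =
      ∑ k ∈ Finset.range (j + 1 + 1),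
        (((j + 1 : ℝ) - 2 * k) * ((j + 1).choose k : ℝ)) • (X : Polynomial ℝ) ^ k := by
  have expand : ((1 + X) ^ (j + 1) : Polynomial ℝ) =
      ∑ k ∈ Finset.range (j + 1 + 1), ((j + 1).choose k : ℝ) • (X : Polynomial ℝ) ^ k := by
    rw [add_comm, add_pow]
    refine Finset.sum_congr rfl fun k _ => ?_
    rw [one_pow, mul_one, Polynomial.smul_eq_C_mul, mul_comm]
    simp
  have expand_derivative : ((j + 1 : ℝ) • (X * (1 + X) ^ j) : Polynomial ℝ) =
      ∑ k ∈ Finset.range (j + 1 + 1),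
        ((k : ℝ) * ((j + 1).choose k : ℝ)) • (X : Polynomial ℝ) ^ k := by
    have h := congrArg (fun p => X * derivative p) expand
    simp only [derivative_sum, derivative_smul, derivative_X_pow, Finset.mul_sum] at h
    rw [derivative_pow] at h
    convert h using 1
    · simp [Polynomial.smul_eq_C_mul]; ring
    · refine Finset.sum_congr rfl fun k _ => ?_
      rcases k with _ | k
      · simp
      · simp [Polynomial.smul_eq_C_mul, pow_succ]; ring
  have split : ((j + 1 : ℝ) • ((1 - X) * (1 + X) ^ j) : Polynomial ℝ) =
      (j + 1 : ℝ) • (1 + X) ^ (j + 1) - (2 : ℝ) • ((j + 1 : ℝ) • (X * (1 + X) ^ j)) := by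
    simp only [Polynomial.smul_eq_C_mul, map_add, map_one, map_natCast, map_ofNat]
    ring
  rw [split, expand, expand_derivative, Finset.smul_sum, Finset.smul_sum,
    ← Finset.sum_sub_distrib]
  refine Finset.sum_congr rfl fun k _ => ?_
  rw [smul_smul, smul_smul, ← sub_smul]
  congr 1
  ring

theorem sum_sq_sub_two_mul_choose (n : ℕ) :
    ∑ k ∈ Finset.range (n + 1), ((n : ℝ) - 2 * k) ^ 2 * (n.choose k : ℝ) = (n : ℝ) * 2 ^ n := by
  have h := congrArg (Polynomial.eval (1 / 2 : ℝ)) (bernsteinPolynomial.variance ℝ n)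
  rw [Polynomial.eval_finsetSum] at h
  have key : ∀ k ∈ Finset.range (n + 1), Polynomial.eval (1 / 2 : ℝ)
      ((n • Polynomial.X - (k : Polynomial ℝ)) ^ 2 * bernsteinPolynomial ℝ n k) =
      ((n : ℝ) - 2 * k) ^ 2 * (n.choose k : ℝ) * ((1 / 4) * (1 / 2) ^ n) := by
    intro k hk
    have hkn : k ≤ n := Nat.lt_succ_iff.mp (Finset.mem_range.mp hk)
    have hpow : (1 / 2 : ℝ) ^ k * (1 / 2) ^ (n - k) = (1 / 2) ^ n := by
      rw [← pow_add, Nat.add_sub_cancel' hkn]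
    simp only [bernsteinPolynomial, Polynomial.eval_mul, Polynomial.eval_pow, Polynomial.eval_sub,
      Polynomial.eval_X, Polynomial.eval_natCast, Polynomial.eval_one,
      nsmul_eq_mul]
    rw [show (1 - 1 / 2 : ℝ) = 1 / 2 by norm_num, ← hpow]
    ring
  rw [Finset.sum_congr rfl key, ← Finset.sum_mul] at h
  simp only [Polynomial.eval_mul, Polynomial.eval_sub, Polynomial.eval_X, Polynomial.eval_one,
    nsmul_eq_mul, Polynomial.eval_natCast] at h
  have h2 : (1 / 2 : ℝ) ^ n * 2 ^ n = 1 := by rw [← mul_pow]; norm_num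
  linear_combination (4 * 2 ^ n) * h - (∑ k ∈ Finset.range (n + 1),
    ((n : ℝ) - 2 * k) ^ 2 * (n.choose k : ℝ)) * h2

theorem sum_abs_sub_two_mul_choose_le (n : ℕ) :
    ∑ k ∈ Finset.range (n + 1), |((n : ℝ) - 2 * k) * (n.choose k : ℝ)| ≤ √n * 2 ^ n := by
  have hsq : √(n : ℝ) * 2 ^ n = √((n : ℝ) * (2 ^ n) ^ 2) := by
    rw [Real.sqrt_mul (by positivity), Real.sqrt_sq (by positivity)]
  rw [hsq]
  refine Real.le_sqrt_of_sq_le ?_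
  have hcs := Finset.sum_mul_sq_le_sq_mul_sq (Finset.range (n + 1))
    (fun k => |(n : ℝ) - 2 * k| * √(n.choose k : ℝ)) (fun k => √(n.choose k : ℝ))
  have hsum : ∑ k ∈ Finset.range (n + 1), (n.choose k : ℝ) = 2 ^ n := by
    exact_mod_cast Nat.sum_range_choose n
  simp only [mul_pow, sq_abs, mul_assoc, Real.mul_self_sqrt (Nat.cast_nonneg _),
    Real.sq_sqrt (Nat.cast_nonneg _), sum_sq_sub_two_mul_choose, hsum] at hcs
  simp only [abs_mul, Nat.abs_cast]
  linarith [hcs, show (n : ℝ) * (2 ^ n) ^ 2 = n * 2 ^ n * 2 ^ n by ring]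

theorem ContinuousLinearMap.norm_pow_apply_le {E : Type*} [NormedAddCommGroup E]
    [NormedSpace ℝ E] {T : E →L[ℝ] E} (hT : ‖T‖ ≤ 1) (n : ℕ) (f : E) : ‖(T ^ n) f‖ ≤ ‖f‖ := by
  induction n with
  | zero => exact le_rfl
  | succ n ih => rw [pow_succ']; exact (T.le_of_opNorm_le hT _).trans (by rwa [one_mul])

theorem ContinuousLinearMap.norm_average_le {E : Type*} [NormedAddCommGroup E]
    [NormedSpace ℝ E] {T : E →L[ℝ] E} (hT : ‖T‖ ≤ 1) :
    ‖(1 / 2 : ℝ) • (1 + T)‖ ≤ 1 := by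
  rw [norm_smul, Real.norm_of_nonneg (by norm_num)]
  have h : ‖(1 : E →L[ℝ] E)‖ ≤ 1 := ContinuousLinearMap.norm_id_le
  linarith [norm_add_le (1 : E →L[ℝ] E) T]

theorem ContinuousLinearMap.norm_pow_le_one {E : Type*} [NormedAddCommGroup E]
    [NormedSpace ℝ E] {T : E →L[ℝ] E} (hT : ‖T‖ ≤ 1) (n : ℕ) : ‖T ^ n‖ ≤ 1 :=
  opNorm_le_bound _ zero_le_one fun f => by
    rw [one_mul]
    exact norm_pow_apply_le hT n f

/-- For a contraction `T`, the powers of `(1 + T) / 2` are asymptotically invariant under `T`. -/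
theorem ContinuousLinearMap.norm_one_sub_mul_average_pow_le {E : Type*} [NormedAddCommGroup E]
    [NormedSpace ℝ E] (T : E →L[ℝ] E) (hT : ‖T‖ ≤ 1) (j : ℕ) :
    ‖(1 - T) * ((1 / 2 : ℝ) • (1 + T)) ^ j‖ ≤ 2 / √(j + 1 : ℝ) := by
  have h := congrArg (Polynomial.aeval T) (Polynomial.one_sub_X_mul_one_add_X_pow j)
  simp only [map_smul, map_mul, map_sub, map_one, map_pow, map_add, Polynomial.aeval_X,
    map_sum] at h
  have hbound : ‖(j + 1 : ℝ) • ((1 - T) * (1 + T) ^ j)‖ ≤ √(j + 1 : ℝ) * 2 ^ (j + 1) := by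
    rw [h]
    refine (norm_sum_le _ _).trans (le_trans (Finset.sum_le_sum fun k _ => ?_)
      (by simpa using sum_abs_sub_two_mul_choose_le (j + 1)))
    rw [norm_smul, Real.norm_eq_abs]
    refine (mul_le_of_le_one_right (abs_nonneg _) (norm_pow_le_one hT k)).trans_eq ?_
    simp [abs_mul]
  have hj : (0 : ℝ) < j + 1 := by positivity
  rw [norm_smul, Real.norm_of_nonneg hj.le] at hbound
  rw [smul_pow, mul_smul_comm, norm_smul, norm_pow, Real.norm_of_nonneg (by norm_num),
    le_div_iff₀ (Real.sqrt_pos.mpr hj)]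
  have hs : 0 < √(j + 1 : ℝ) := Real.sqrt_pos.mpr hj
  have hss : √(j + 1 : ℝ) * √(j + 1 : ℝ) = j + 1 := Real.mul_self_sqrt hj.le
  have hle : √(j + 1 : ℝ) * ‖(1 - T) * (1 + T) ^ j‖ ≤ 2 ^ (j + 1) := by
    refine le_of_mul_le_mul_left ?_ hs
    rwa [← mul_assoc, hss]
  have h2 : (1 / 2 : ℝ) ^ j * 2 ^ (j + 1) = 2 := by
    rw [pow_succ, ← mul_assoc, ← mul_pow]; norm_num
  calc (1 / 2 : ℝ) ^ j * ‖(1 - T) * (1 + T) ^ j‖ * √(j + 1 : ℝ)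
      = (1 / 2 : ℝ) ^ j * (√(j + 1 : ℝ) * ‖(1 - T) * (1 + T) ^ j‖) := by ring
    _ ≤ (1 / 2 : ℝ) ^ j * 2 ^ (j + 1) := by gcongr
    _ = 2 := h2

end BinomialAverages

section PositiveContractions

theorem norm_sub_inf_add_norm_sub_inf {E : Type*} [NormedAddCommGroup E] [Lattice E]
    [IsOrderedAddMonoid E] [HasSolidNorm E]
    (hadd : ∀ x y : E, 0 ≤ x → 0 ≤ y → ‖x + y‖ = ‖x‖ + ‖y‖) (x y : E) :
    ‖x - x ⊓ y‖ + ‖y - x ⊓ y‖ = ‖x - y‖ := by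
  have hsum : x - x ⊓ y + (y - x ⊓ y) = |x - y| := by
    have habs := sup_sub_inf_eq_abs_sub y x
    rw [sup_comm, inf_comm] at habs
    rw [← habs, ← add_sub_cancel_left (x ⊓ y) (x ⊔ y), inf_add_sup]
    abel
  rw [← hadd _ _ (sub_nonneg.mpr inf_le_left) (sub_nonneg.mpr inf_le_right), hsum,
    norm_abs_eq_norm]

variable {E : Type*} [NormedAddCommGroup E] [NormedSpace ℝ E] [Lattice E]

/-- Each `T ^ K f` with `0 ≤ f` splits as `((1 + T) / 2) ^ j a + q` with `a` and `q` positive, of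
total norm at most `‖f‖`, and with remainder satisfying `‖q‖ ≤ δ * ‖f‖`. -/
def HasAveragedSplitting (T : E →L[ℝ] E) (K j : ℕ) (δ : ℝ) : Prop :=
  ∀ f : E, 0 ≤ f → ∃ a q : E, 0 ≤ a ∧ 0 ≤ q ∧
    (T ^ K) f = (((1 / 2 : ℝ) • (1 + T)) ^ j) a + q ∧ ‖a‖ + ‖q‖ ≤ ‖f‖ ∧ ‖q‖ ≤ δ * ‖f‖

theorem ContinuousLinearMap.pow_apply_nonneg {T : E →L[ℝ] E} (hpos : ∀ f : E, 0 ≤ f → 0 ≤ T f)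
    (n : ℕ) {f : E} (hf : 0 ≤ f) : 0 ≤ (T ^ n) f := by
  induction n with
  | zero => exact hf
  | succ n ih => rw [pow_succ']; exact hpos _ ih

variable [IsOrderedAddMonoid E] {T : E →L[ℝ] E}

theorem HasAveragedSplitting.pow {N : ℕ} {ρ : ℝ} (hρ : 0 ≤ ρ)
    (hpos : ∀ f : E, 0 ≤ f → 0 ≤ T f) (hT : ‖T‖ ≤ 1) (h : HasAveragedSplitting T N 1 ρ) (k : ℕ) :
    HasAveragedSplitting T (N * k) 1 (ρ ^ k) := by
  induction k with
  | zero => exact fun f hf => ⟨0, f, le_rfl, hf, by simp, by simp, by simp⟩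
  | succ k ih =>
    intro f hf
    obtain ⟨a, q, ha, hq, hfaq, hnorm, hqf⟩ := ih f hf
    obtain ⟨b, r, hb, hr, hqbr, hnorm', hrq⟩ := h q hq
    refine ⟨(T ^ N) a + b, r, add_nonneg (T.pow_apply_nonneg hpos N ha) hb, hr, ?_, ?_, ?_⟩
    · rw [Nat.mul_succ, add_comm, pow_add, mul_apply_eq_comp, hfaq, map_add, hqbr,
        map_add, add_assoc, ← mul_apply_eq_comp, ← mul_apply_eq_comp]
      have hcomm : Commute (T ^ N) (((1 / 2 : ℝ) • (1 + T)) ^ 1) :=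
        (((Commute.one_right T).add_right (Commute.refl T)).smul_right _).pow_pow _ _
      rw [hcomm.eq]
    · linarith [norm_add_le ((T ^ N) a) b, ContinuousLinearMap.norm_pow_apply_le hT N a]
    · calc ‖r‖ ≤ ρ * ‖q‖ := hrq
        _ ≤ ρ * (ρ ^ k * ‖f‖) := by gcongr
        _ = ρ ^ (k + 1) * ‖f‖ := by ring

theorem HasAveragedSplitting.norm_pow_succ_sub_pow_le [HasSolidNorm E]
    (hadd : ∀ x y : E, 0 ≤ x → 0 ≤ y → ‖x + y‖ = ‖x‖ + ‖y‖) (hT : ‖T‖ ≤ 1)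
    {K j : ℕ} {δ : ℝ} (hδ : 0 ≤ δ) (h : HasAveragedSplitting T K j δ) :
    ‖T ^ (K + 1) - T ^ K‖ ≤ 2 / √(j + 1 : ℝ) + 2 * δ := by
  have hcone (f : E) (hf : 0 ≤ f) :
      ‖(T ^ (K + 1) - T ^ K) f‖ ≤ (2 / √(j + 1 : ℝ) + 2 * δ) * ‖f‖ := by
    obtain ⟨a, q, ha, hq, heq, hnorm, hqf⟩ := h f hf
    set P := (1 / 2 : ℝ) • (1 + T) with hP
    have hsplit : (T ^ (K + 1) - T ^ K) f = -(((1 - T) * P ^ j) a + (q - T q)) := by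
      rw [sub_apply, pow_succ', mul_apply_eq_comp,
        mul_apply_eq_comp, heq, map_add, sub_apply,
        one_apply_eq_self]
      abel
    have hPa := ((1 - T) * P ^ j).le_of_opNorm_le (T.norm_one_sub_mul_average_pow_le hT j) a
    have haf : 2 / √(j + 1 : ℝ) * ‖a‖ ≤ 2 / √(j + 1 : ℝ) * ‖f‖ := by
      gcongr
      linarith [norm_nonneg q]
    have hTq : ‖T q‖ ≤ ‖q‖ := by simpa using T.le_of_opNorm_le hT q
    rw [hsplit, norm_neg]
    linarith [norm_add_le (((1 - T) * P ^ j) a) (q - T q), norm_sub_le q (T q)]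
  refine ContinuousLinearMap.opNorm_le_bound _ (by positivity) fun f => ?_
  have hf : ‖f‖ = ‖f⁺‖ + ‖f⁻‖ := by
    rw [← hadd _ _ (posPart_nonneg f) (negPart_nonneg f), posPart_add_negPart, norm_abs_eq_norm]
  calc ‖(T ^ (K + 1) - T ^ K) f‖
      = ‖(T ^ (K + 1) - T ^ K) f⁺ - (T ^ (K + 1) - T ^ K) f⁻‖ := by
        rw [← map_sub, posPart_sub_negPart]
    _ ≤ (2 / √(j + 1 : ℝ) + 2 * δ) * ‖f‖ := by
        rw [hf, mul_add]
        exact (norm_sub_le _ _).trans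
          (add_le_add (hcone _ (posPart_nonneg f)) (hcone _ (negPart_nonneg f)))

variable [PosSMulMono ℝ E]

theorem ContinuousLinearMap.average_apply_nonneg (hpos : ∀ f : E, 0 ≤ f → 0 ≤ T f) (f : E)
    (hf : 0 ≤ f) : 0 ≤ ((1 / 2 : ℝ) • (1 + T)) f :=
  smul_nonneg (by norm_num) (add_nonneg hf (hpos f hf))

theorem hasAveragedSplitting_of_norm_sub [HasSolidNorm E]
    (hadd : ∀ x y : E, 0 ≤ x → 0 ≤ y → ‖x + y‖ = ‖x‖ + ‖y‖)
    (hpos : ∀ f : E, 0 ≤ f → 0 ≤ T f) (hT : ‖T‖ ≤ 1) (m : ℕ) :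
    HasAveragedSplitting T (m + 1) 1 (‖T ^ (m + 1) - T ^ m‖ / 2) := by
  intro f hf
  set x := (T ^ m) f with hx
  set y := (T ^ (m + 1)) f with hy
  have hxy : y = T x := by rw [hx, hy, pow_succ']; rfl
  have hx0 : 0 ≤ x := T.pow_apply_nonneg hpos m hf
  have hy0 : 0 ≤ y := T.pow_apply_nonneg hpos (m + 1) hf
  have hs0 : 0 ≤ x ⊓ y := le_inf hx0 hy0
  have hr : 0 ≤ x - x ⊓ y := sub_nonneg.mpr inf_le_left
  have hr' : 0 ≤ y - x ⊓ y := sub_nonneg.mpr inf_le_right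
  have hnorm := norm_sub_inf_add_norm_sub_inf hadd x y
  have hxs := hadd _ _ hs0 hr
  have hys := hadd _ _ hs0 hr'
  rw [add_sub_cancel] at hxs hys
  have hxf : ‖x‖ ≤ ‖f‖ := ContinuousLinearMap.norm_pow_apply_le hT m f
  have hyf : ‖y‖ ≤ ‖f‖ := ContinuousLinearMap.norm_pow_apply_le hT (m + 1) f
  have hTr : ‖T (x - x ⊓ y)‖ ≤ ‖x - x ⊓ y‖ := by simpa using T.le_of_opNorm_le hT (x - x ⊓ y)
  have hq : ‖(1 / 2 : ℝ) • ((y - x ⊓ y) + T (x - x ⊓ y))‖ ≤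
      (‖x - x ⊓ y‖ + ‖y - x ⊓ y‖) / 2 := by
    rw [norm_smul, Real.norm_of_nonneg (by norm_num)]
    linarith [norm_add_le (y - x ⊓ y) (T (x - x ⊓ y))]
  refine ⟨x ⊓ y, (1 / 2 : ℝ) • ((y - x ⊓ y) + T (x - x ⊓ y)), hs0,
    smul_nonneg (by norm_num) (add_nonneg hr' (hpos _ hr)), ?_, by linarith, ?_⟩
  · rw [pow_one, map_sub, ← hxy]
    simp only [smul_apply, add_apply,
      one_apply_eq_self]
    module
  · have hD : ‖x - y‖ ≤ ‖T ^ (m + 1) - T ^ m‖ * ‖f‖ := by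
      rw [norm_sub_rev]
      exact (T ^ (m + 1) - T ^ m).le_opNorm f
    linarith

theorem HasAveragedSplitting.comp {K K' j : ℕ} {δ δ' : ℝ} (hδ' : 0 ≤ δ')
    (hpos : ∀ f : E, 0 ≤ f → 0 ≤ T f) (hT : ‖T‖ ≤ 1)
    (h : HasAveragedSplitting T K j δ) (h' : HasAveragedSplitting T K' 1 δ') :
    HasAveragedSplitting T (K' + K) (j + 1) (δ + δ') := by
  intro f hf
  obtain ⟨a, q, ha, hq, hfaq, hnorm, hqf⟩ := h f hf
  obtain ⟨b, r, hb, hr, habr, hnorm', hra⟩ := h' a ha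
  set P := (1 / 2 : ℝ) • (1 + T) with hP
  have hPr : ‖(P ^ j) r‖ ≤ ‖r‖ :=
    ContinuousLinearMap.norm_pow_apply_le (ContinuousLinearMap.norm_average_le hT) j r
  have hTq : ‖(T ^ K') q‖ ≤ ‖q‖ := ContinuousLinearMap.norm_pow_apply_le hT K' q
  have htri := norm_add_le ((P ^ j) r) ((T ^ K') q)
  refine ⟨b, (P ^ j) r + (T ^ K') q, hb, add_nonneg
    (P.pow_apply_nonneg (ContinuousLinearMap.average_apply_nonneg hpos) j hr)
    (T.pow_apply_nonneg hpos K' hq), ?_, by linarith, ?_⟩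
  · have hcomm : Commute (T ^ K') (P ^ j) :=
      (((Commute.one_right T).add_right (Commute.refl T)).smul_right _).pow_pow _ _
    rw [pow_add, mul_apply_eq_comp, hfaq, map_add, ← mul_apply_eq_comp,
      hcomm.eq, mul_apply_eq_comp, habr, map_add, ← mul_apply_eq_comp,
      pow_one, ← pow_succ, add_assoc]
  · have hδa : δ' * ‖a‖ ≤ δ' * ‖f‖ := by
      gcongr
      linarith [norm_nonneg q]
    linarith

theorem exists_hasAveragedSplitting {N : ℕ} {ρ : ℝ} (hρ : 0 ≤ ρ) (hρ1 : ρ < 1)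
    (hpos : ∀ f : E, 0 ≤ f → 0 ≤ T f) (hT : ‖T‖ ≤ 1) (h : HasAveragedSplitting T N 1 ρ) (j : ℕ) :
    ∀ δ > 0, ∃ K, HasAveragedSplitting T K j δ := by
  induction j with
  | zero =>
    exact fun δ hδ => ⟨0, fun f hf => ⟨f, 0, hf, le_rfl, by simp, by simp, by simp; positivity⟩⟩
  | succ j ih =>
    intro δ hδ
    obtain ⟨K, hK⟩ := ih (δ / 2) (half_pos hδ)
    obtain ⟨k, hk⟩ := exists_pow_lt_of_lt_one (half_pos hδ) hρ1
    refine ⟨N * k + K, fun f hf => ?_⟩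
    obtain ⟨a, q, ha, hq, heq, hnorm, hqf⟩ :=
      hK.comp (pow_nonneg hρ k) hpos hT (h.pow hρ hpos hT k) f hf
    refine ⟨a, q, ha, hq, heq, hnorm, hqf.trans ?_⟩
    gcongr
    linarith

/-- A positive contraction on an abstract `L¹`-space with `‖T ^ (m + 1) - T ^ m‖ < 2` for some `m`
satisfies `‖T ^ (n + 1) - T ^ n‖ → 0`. -/
theorem tendsto_norm_pow_succ_sub_pow [HasSolidNorm E]
    (hadd : ∀ x y : E, 0 ≤ x → 0 ≤ y → ‖x + y‖ = ‖x‖ + ‖y‖)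
    (hpos : ∀ f : E, 0 ≤ f → 0 ≤ T f) (hT : ‖T‖ ≤ 1) {m : ℕ}
    (hm : ‖T ^ (m + 1) - T ^ m‖ < 2) :
    Tendsto (fun n : ℕ => ‖T ^ (n + 1) - T ^ n‖) atTop (nhds 0) := by
  have hanti : Antitone fun n : ℕ => ‖T ^ (n + 1) - T ^ n‖ := by
    refine antitone_nat_of_succ_le fun n => ?_
    rw [pow_succ' T (n + 1), pow_succ' T n, ← mul_sub, ← pow_succ']
    exact (norm_mul_le _ _).trans (mul_le_of_le_one_left (norm_nonneg _) hT)
  rw [Metric.tendsto_atTop]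
  intro ε hε
  have hlim : Tendsto (fun j : ℕ => 2 / √(j + 1 : ℝ)) atTop (nhds 0) :=
    tendsto_const_nhds.div_atTop (Real.tendsto_sqrt_atTop.comp
      (tendsto_atTop_add_const_right _ _ tendsto_natCast_atTop_atTop))
  obtain ⟨j, hj⟩ := (hlim.eventually_lt_const (half_pos hε)).exists
  obtain ⟨K, hK⟩ := exists_hasAveragedSplitting (by positivity) (by linarith) hpos hT
    (hasAveragedSplitting_of_norm_sub hadd hpos hT m) j (ε / 4) (by positivity)
  refine ⟨K, fun n hn => ?_⟩
  rw [Real.dist_0_eq_abs, abs_norm]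
  linarith [hanti hn, hK.norm_pow_succ_sub_pow_le hadd hT (by positivity)]

end PositiveContractions

theorem MeasureTheory.Lp.norm_add_of_nonneg {Ω : Type*} [MeasurableSpace Ω] {μ : Measure Ω}
    (f g : Lp ℝ 1 μ) (hf : 0 ≤ f) (hg : 0 ≤ g) : ‖f + g‖ = ‖f‖ + ‖g‖ := by
  rw [L1.norm_eq_integral_norm, L1.norm_eq_integral_norm, L1.norm_eq_integral_norm,
    ← integral_add (L1.integrable_coeFn f).norm (L1.integrable_coeFn g).norm]
  refine integral_congr_ae ?_
  filter_upwards [Lp.coeFn_add f g, (Lp.coeFn_nonneg f).mpr hf, (Lp.coeFn_nonneg g).mpr hg]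
    with x hx hfx hgx
  simp only [Pi.zero_apply] at hfx hgx
  rw [hx, Pi.add_apply, Real.norm_of_nonneg hfx, Real.norm_of_nonneg hgx,
    Real.norm_of_nonneg (add_nonneg hfx hgx)]

theorem MeasureTheory.Lp.posSMulMono_real {Ω : Type*} [MeasurableSpace Ω] {μ : Measure Ω} :
    PosSMulMono ℝ (Lp ℝ 1 μ) where
  smul_le_smul_of_nonneg_left c hc f g hfg := by
    rw [← Lp.coeFn_le] at hfg ⊢
    filter_upwards [hfg, Lp.coeFn_smul c f, Lp.coeFn_smul c g] with x hx hf hg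
    rw [hf, hg]
    exact mul_le_mul_of_nonneg_left hx hc

/-- Ornstein–Sucheston "zero-two" law: for a positive linear contraction `T` on `L¹(μ)` of a
σ-finite measure space, exactly one of the following holds: either `‖T^{n+1} - T^n‖ = 2` for
every `n`, or `‖T^{n+1} - T^n‖ → 0`. -/
theorem zero_two_law_L1 {Ω : Type*} [MeasurableSpace Ω] (μ : Measure Ω) [SigmaFinite μ]
    (T : Lp ℝ 1 μ →L[ℝ] Lp ℝ 1 μ)
    (hTpos : ∀ f : Lp ℝ 1 μ, 0 ≤ f → 0 ≤ T f) (hT : ‖T‖ ≤ 1) :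
    Xor' (∀ n : ℕ, ‖T ^ (n + 1) - T ^ n‖ = 2)
      (Tendsto (fun n : ℕ => ‖T ^ (n + 1) - T ^ n‖) atTop (nhds 0)) := by
  by_cases h : ∀ n : ℕ, ‖T ^ (n + 1) - T ^ n‖ = 2
  · refine Or.inl ⟨h, fun hlim => ?_⟩
    simp only [h] at hlim
    exact two_ne_zero (tendsto_nhds_unique tendsto_const_nhds hlim)
  · refine Or.inr ⟨?_, h⟩
    push Not at h
    obtain ⟨m, hm⟩ := h
    have hle : ‖T ^ (m + 1) - T ^ m‖ ≤ 2 := by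
      linarith [norm_sub_le (T ^ (m + 1)) (T ^ m),
        ContinuousLinearMap.norm_pow_le_one hT (m + 1), ContinuousLinearMap.norm_pow_le_one hT m]
    have := Lp.posSMulMono_real (μ := μ)
    exact tendsto_norm_pow_succ_sub_pow Lp.norm_add_of_nonneg hTpos hT (lt_of_le_of_ne hle hm)
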